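/- Let C be a category satisfying condition 𝔼 and let a, b be objects of C. The following are equivalent: (i) a ≅ b; (ii) h^a(c) = h^b(c) for every object c of C; (iii) m^a(c) = m^b(c) for every object c of C. -/

import Mathlib

open CategoryTheory

universe v u

/-- Morphisms in `C` admit epi-mono factorization: every morphism factors as an epimorphism
followed by a monomorphism, uniquely up to isomorphism. -/
def HasEpiMonoFactorization (C : Type u) [Category.{v} C] : Prop :=
  ∀ ⦃a b : C⦄ (f : a ⟶ b), ∃ (m : C) (p : a ⟶ m) (i : m ⟶ b),
    Epi p ∧ Mono i ∧ p ≫ i = f ∧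
      ∀ (m' : C) (p' : a ⟶ m') (i' : m' ⟶ b), Epi p' → Mono i' → p' ≫ i' = f →
        ∃ δ : m ≅ m', p ≫ δ.hom = p' ∧ δ.hom ≫ i' = i

/-- Condition 𝔼: `C` is locally finite, morphisms admit epi-mono factorization, and for every
object `c` the poset of quotients of `c` (subobjects of `c` in the opposite category), ordered
by `d ≤ d'` iff there is an epimorphism `d' ⟶ d`, is well-founded (with respect to the
associated strict order). -/
def ConditionE (C : Type u) [Category.{v} C] : Prop :=
  (∀ a b : C, Finite (a ⟶ b)) ∧ HasEpiMonoFactorization C ∧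
    ∀ c : C, WellFounded (fun S T : Subobject (Opposite.op c) =>
      (∃ f : (Subobject.underlying.obj T).unop ⟶ (Subobject.underlying.obj S).unop, Epi f) ∧
        ¬ ∃ f : (Subobject.underlying.obj S).unop ⟶ (Subobject.underlying.obj T).unop, Epi f)

/-- Two families of finite total size with equal totals, which agree in size away from one index,
also agree in size at that index. -/
theorem Nat.card_eq_of_card_sigma_eq.{w} {ι : Type*} {β γ : ι → Type w} [Finite (Σ i, β i)]
    [Finite (Σ i, γ i)] (i₀ : ι) (htotal : Nat.card (Σ i, β i) = Nat.card (Σ i, γ i))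
    (hne : ∀ i, i ≠ i₀ → Nat.card (β i) = Nat.card (γ i)) :
    Nat.card (β i₀) = Nat.card (γ i₀) := by
  classical
  have split (δ : ι → Type w) [Finite (Σ i, δ i)] : Nat.card (Σ i, δ i) =
      Nat.card (δ i₀) + Nat.card (Σ i : { i // i ≠ i₀ }, δ i) := by
    rw [← Nat.card_congr (Equiv.sumCompl fun x : Σ i, δ i => x.1 = i₀), Nat.card_sum,
      Nat.card_congr (Equiv.sigmaSubtype i₀),
      Nat.card_congr (Equiv.subtypeSigmaEquiv δ fun i => i ≠ i₀)]
  have fiber (δ : ι → Type w) [Finite (Σ i, δ i)] (i : ι) : Finite (δ i) :=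
    Finite.of_injective (Sigma.mk i) sigma_mk_injective
  have rest : Nat.card (Σ i : { i // i ≠ i₀ }, β i) = Nat.card (Σ i : { i // i ≠ i₀ }, γ i) :=
    Nat.card_congr <| Equiv.sigmaCongrRight fun i =>
      have := fiber β i
      have := fiber γ i
      Classical.choice (Finite.card_eq.1 (hne i i.2))
  have hβ := split β
  have hγ := split γ
  omega

namespace CategoryTheory

variable {C : Type u} [Category.{v} C]

theorem isIso_of_epi_of_finite_end {a : C} [Finite (a ⟶ a)] (f : a ⟶ a) [Epi f] : IsIso f := by
  have hinj : Function.Injective fun g : a ⟶ a => f ≫ g := fun _ _ h => (cancel_epi f).1 h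
  obtain ⟨g, hg⟩ := Finite.surjective_of_injective hinj (𝟙 a)
  have : IsSplitMono f := ⟨⟨⟨g, hg⟩⟩⟩
  exact isIso_of_epi_of_isSplitMono f

theorem isIso_of_mono_of_finite_end {a : C} [Finite (a ⟶ a)] (f : a ⟶ a) [Mono f] : IsIso f := by
  have hinj : Function.Injective fun g : a ⟶ a => g ≫ f := fun _ _ h => (cancel_mono f).1 h
  obtain ⟨g, hg⟩ := Finite.surjective_of_injective hinj (𝟙 a)
  have : IsSplitEpi f := ⟨⟨⟨g, hg⟩⟩⟩
  exact isIso_of_mono_of_isSplitEpi f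

theorem isIso_of_epi_of_epi {a b : C} [Finite (a ⟶ a)] (f : a ⟶ b) (g : b ⟶ a) [Epi f]
    [Epi g] : IsIso f := by
  have := isIso_of_epi_of_finite_end (f ≫ g)
  have : IsSplitMono f :=
    ⟨⟨⟨g ≫ inv (f ≫ g), by rw [← Category.assoc, IsIso.hom_inv_id]⟩⟩⟩
  exact isIso_of_epi_of_isSplitMono f

theorem isIso_of_mono_of_mono {a b : C} [Finite (b ⟶ b)] (f : a ⟶ b) (g : b ⟶ a) [Mono f]
    [Mono g] : IsIso f := by
  have := isIso_of_mono_of_finite_end (g ≫ f)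
  have : IsSplitEpi f :=
    ⟨⟨⟨inv (g ≫ f) ≫ g, by rw [Category.assoc, IsIso.inv_hom_id]⟩⟩⟩
  exact isIso_of_mono_of_isSplitEpi f

theorem card_mono_congr {c d : C} (e : c ≅ d) (a : C) :
    Nat.card { f : c ⟶ a // Mono f } = Nat.card { f : d ⟶ a // Mono f } :=
  Nat.card_congr <| (e.homCongr (Iso.refl a)).subtypeEquiv fun f => by
    simp only [Iso.homCongr_apply, Iso.refl_hom, Category.comp_id]
    refine ⟨fun _ => mono_comp _ _, fun _ => ?_⟩
    simpa using mono_comp e.hom (e.inv ≫ f)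

end CategoryTheory

/-- The monomorphisms from quotients of `c` to `a` correspond to the morphisms `c ⟶ a`. -/
theorem HasEpiMonoFactorization.bijective_comp {C : Type u} [Category.{v} C]
    (h : HasEpiMonoFactorization C) (c a : C) :
    Function.Bijective
      fun x : Σ q : Subobject (Opposite.op c), { i : (q : Cᵒᵖ).unop ⟶ a // Mono i } =>
        x.1.arrow.unop ≫ x.2.1 := by
  constructor
  · rintro ⟨q, i, hi⟩ ⟨q', i', hi'⟩ heq
    dsimp only at heq
    obtain ⟨m, p, j, _, _, _, huniq⟩ := h (q.arrow.unop ≫ i)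
    obtain ⟨δ, hδ, _⟩ := huniq _ q.arrow.unop i inferInstance hi rfl
    obtain ⟨δ', hδ', _⟩ := huniq _ q'.arrow.unop i' inferInstance hi' heq.symm
    obtain rfl : q' = q := Subobject.eq_of_comm (δ.symm ≪≫ δ').op <| Quiver.Hom.unop_inj <| by
      simp [← hδ, ← hδ']
    obtain rfl := (cancel_epi q'.arrow.unop).1 heq
    rfl
  · intro f
    obtain ⟨m, p, i, _, _, hf, _⟩ := h f
    refine ⟨⟨Subobject.mk p.op, (Subobject.underlyingIso p.op).inv.unop ≫ i, inferInstance⟩, ?_⟩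
    rw [← hf]
    change (Subobject.mk p.op).arrow.unop ≫ _ ≫ i = _
    rw [← Category.assoc, ← unop_comp, Subobject.underlyingIso_arrow]
    rfl

namespace ConditionE

variable {C : Type u} [Category.{v} C]

theorem card_mono_quotient_eq (hE : ConditionE C) {a b : C}
    (hab : ∀ c : C, Nat.card (c ⟶ a) = Nat.card (c ⟶ b)) {c : C} (S : Subobject (Opposite.op c)) :
    Nat.card { f : (S : Cᵒᵖ).unop ⟶ a // Mono f } =
      Nat.card { f : (S : Cᵒᵖ).unop ⟶ b // Mono f } := by
  obtain ⟨hfin, hfact, hwf⟩ := hE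
  induction S using (hwf c).induction with
  | _ S ih =>
  set d : C := (S : Cᵒᵖ).unop
  have total (x : C) := Equiv.ofBijective _ (hfact.bijective_comp d x)
  have (x : C) := Finite.of_equiv _ (total x).symm
  have top (x : C) := card_mono_congr (Subobject.underlyingIso (𝟙 (Opposite.op d))).unop x
  rw [top a, top b]
  refine Nat.card_eq_of_card_sigma_eq
    (β := fun q : Subobject (Opposite.op d) => { i : (q : Cᵒᵖ).unop ⟶ a // Mono i })
    (γ := fun q : Subobject (Opposite.op d) => { i : (q : Cᵒᵖ).unop ⟶ b // Mono i })
    (Subobject.mk (𝟙 (Opposite.op d)))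
    (by rw [Nat.card_congr (total a), Nat.card_congr (total b), hab]) fun q hq => ?_
  let arrow : (q : Cᵒᵖ) ⟶ (S : Cᵒᵖ) := q.arrow
  have : Mono arrow := inferInstanceAs (Mono q.arrow)
  let e := Subobject.underlyingIso (arrow ≫ S.arrow)
  rw [card_mono_congr e.unop a, card_mono_congr e.unop b]
  refine ih _ ⟨⟨arrow.unop ≫ e.hom.unop, epi_comp _ _⟩, ?_⟩
  rintro ⟨g, hg⟩
  have := hfin d d
  have : Epi (e.hom.unop ≫ g) := epi_comp _ _
  have : IsIso arrow.unop := isIso_of_epi_of_epi arrow.unop (e.hom.unop ≫ g)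
  have : IsIso q.arrow := (isIso_unop_iff arrow).1 this
  exact hq <| Subobject.eq_mk_of_comm _ (asIso q.arrow) (by simp)

theorem card_mono_eq (hE : ConditionE C) {a b : C}
    (hab : ∀ c : C, Nat.card (c ⟶ a) = Nat.card (c ⟶ b)) (c : C) :
    Nat.card { f : c ⟶ a // Mono f } = Nat.card { f : c ⟶ b // Mono f } := by
  have top (x : C) := card_mono_congr (Subobject.underlyingIso (𝟙 (Opposite.op c))).unop x
  exact (top a).trans <| (hE.card_mono_quotient_eq hab _).trans (top b).symm

theorem nonempty_iso_of_card_mono_eq (hE : ConditionE C) {a b : C}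
    (hab : ∀ c : C, Nat.card { f : c ⟶ a // Mono f } = Nat.card { f : c ⟶ b // Mono f }) :
    Nonempty (a ≅ b) := by
  have hfin := hE.1
  have pos (x : C) : 0 < Nat.card { f : x ⟶ x // Mono f } :=
    have : Nonempty { f : x ⟶ x // Mono f } := ⟨⟨𝟙 x, inferInstance⟩⟩
    Nat.card_pos
  obtain ⟨⟨f, _⟩⟩ := (Nat.card_pos_iff.1 (hab a ▸ pos a)).1
  obtain ⟨⟨g, _⟩⟩ := (Nat.card_pos_iff.1 ((hab b).symm ▸ pos b)).1
  have := isIso_of_mono_of_mono f g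
  exact ⟨asIso f⟩

end ConditionE

/-- Under condition 𝔼, for objects `a, b` the following are equivalent:
(i) `a ≅ b`; (ii) `|Hom(c,a)| = |Hom(c,b)|` for every `c`; (iii) `|Mono(c,a)| = |Mono(c,b)|`
for every `c`. -/
theorem iso_iff_homCount_eq_iff_monoCount_eq (C : Type u) [Category.{v} C]
    (hE : ConditionE C) (a b : C) :
    List.TFAE
      [Nonempty (a ≅ b),
       ∀ c : C, Nat.card (c ⟶ a) = Nat.card (c ⟶ b),
       ∀ c : C, Nat.card { f : c ⟶ a // Mono f } = Nat.card { f : c ⟶ b // Mono f }] := by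
  tfae_have 1 → 2 := fun ⟨e⟩ c => Nat.card_congr ((Iso.refl c).homCongr e)
  tfae_have 2 → 3 := hE.card_mono_eq
  tfae_have 3 → 1 := hE.nonempty_iso_of_card_mono_eq
  tfae_finish
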